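/- Fix k > 5+γ with γ ∈ [0,1]. For every δ > 0 and every measurable h: Ω×ℝ³ → ℝ with sup_{x}|h(x,v)| ≤ ‖h‖ ⟨v⟩^{−k}, the truncated collision operator B₂^{(δ)}h(x,v) = ∫_{ℝ³×S²}(1−Θ_δ)[μ'_* h' + μ' h'_* − μ h_*] b(cos θ)|v−v_*|^γ dσ dv_* satisfies ∫_{ℝ³} sup_{x∈Ω}|B₂^{(δ)}h(x,v)| ⟨v⟩² dv ≤ Δ̃_k(δ) ‖h‖, where Δ̃_k(δ) = 3∫_{Ξ̃_δ} μ_* ⟨v_*⟩² ⟨v⟩^{2−k}|v−v_*|^γ b(cos θ), and Δ̃_k(δ) → 0 as δ → 0. -/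

import Mathlib

open MeasureTheory
open scoped RealInnerProductSpace ENNReal

/-- The standard Maxwellian on ℝ³. -/
noncomputable def gauss (v : EuclideanSpace ℝ (Fin 3)) : ℝ :=
  (2 * Real.pi) ^ (-(3:ℝ)/2) * Real.exp (-‖v‖ ^ 2 / 2)

/-- `⟨v⟩ = √(1+|v|²)`. -/
noncomputable def jap (v : EuclideanSpace ℝ (Fin 3)) : ℝ :=
  Real.sqrt (1 + ‖v‖ ^ 2)

/-- The bad set Ξ̃_δ of collision configurations. -/
def XiTilde (δ : ℝ) (v vs σ : EuclideanSpace ℝ (Fin 3)) : Prop :=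
  Real.sqrt (‖v‖ ^ 2 + ‖vs‖ ^ 2) ≥ 1 / δ ∨ ‖v - vs‖ ≤ 2 * δ ∨ ‖v - vs‖ ≥ 1 / δ ∨
    (1 - δ ≤ |⟪‖v - vs‖⁻¹ • (v - vs), σ⟫| ∧ |⟪‖v - vs‖⁻¹ • (v - vs), σ⟫| ≤ 1)

/-- `Δ̃_k(δ) = 3 ∫_{Ξ̃_δ} μ(v_*)⟨v_*⟩²⟨v⟩^{2-k}|v-v_*|^γ b(cos θ)`. -/
noncomputable def DeltaTilde (γ k : ℝ) (b : ℝ → ℝ) (δ : ℝ) : ℝ≥0∞ :=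
  3 * ∫⁻ vs : EuclideanSpace ℝ (Fin 3), ∫⁻ v : EuclideanSpace ℝ (Fin 3),
    ∫⁻ σ in Metric.sphere (0 : EuclideanSpace ℝ (Fin 3)) 1,
      Set.indicator {σ' : EuclideanSpace ℝ (Fin 3) | XiTilde δ v vs σ'}
        (fun σ' => ENNReal.ofReal
          (gauss vs * jap vs ^ 2 * jap v ^ (2 - k) * ‖v - vs‖ ^ γ *
            b ⟪‖v - vs‖⁻¹ • (v - vs), σ'⟫)) σ ∂μH[2]

/-- The truncated collision operator `B₂^{(δ)}` associated to the cutoff `Θ`. -/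
noncomputable def B2 (γ : ℝ) (b : ℝ → ℝ)
    (Θ : EuclideanSpace ℝ (Fin 3) × EuclideanSpace ℝ (Fin 3) ×
      EuclideanSpace ℝ (Fin 3) → ℝ)
    (h : EuclideanSpace ℝ (Fin 3) → EuclideanSpace ℝ (Fin 3) → ℝ)
    (x v : EuclideanSpace ℝ (Fin 3)) : ℝ :=
  ∫ vs : EuclideanSpace ℝ (Fin 3),
    (∫ σ in Metric.sphere (0 : EuclideanSpace ℝ (Fin 3)) 1,
      (1 - Θ (v, vs, σ)) *
        (gauss (((1:ℝ)/2) • (v + vs) - (‖v - vs‖ / 2) • σ) *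
            h x (((1:ℝ)/2) • (v + vs) + (‖v - vs‖ / 2) • σ) +
          gauss (((1:ℝ)/2) • (v + vs) + (‖v - vs‖ / 2) • σ) *
            h x (((1:ℝ)/2) • (v + vs) - (‖v - vs‖ / 2) • σ) -
          gauss v * h x vs) *
        b ⟪‖v - vs‖⁻¹ • (v - vs), σ⟫ * ‖v - vs‖ ^ γ ∂μH[2])

/-- Christensen's lemma: uniformly distributed finite measures are proportional. -/
theorem unif_distrib_aux {X : Type*} [PseudoMetricSpace X] [SecondCountableTopology X]
    [MeasurableSpace X] [BorelSpace X] [Nonempty X] (ν η : Measure X) [IsFiniteMeasure ν]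
    [IsFiniteMeasure η] [ν.IsOpenPosMeasure]
    (hν : ∀ (ε : ℝ) (x y : X), ν (Metric.ball x ε) = ν (Metric.ball y ε))
    (hη : ∀ (ε : ℝ) (x y : X), η (Metric.ball x ε) = η (Metric.ball y ε)) :
    ∃ c : ℝ≥0∞, c ≠ ∞ ∧ η = c • ν := by
  obtain ⟨x₀⟩ := ‹Nonempty X›
  have hS0 : ν Set.univ ≠ 0 := (isOpen_univ.measure_pos ν ⟨x₀, trivial⟩).ne'
  have hST : ν Set.univ ≠ ∞ := measure_ne_top _ _
  -- the double integral
  have key : ∀ (U : Set X), IsOpen U → ∀ ε : ℝ,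
      ∫⁻ x, ν {y | (x ∈ U ∧ y ∈ U) ∧ dist y x < ε} ∂η =
        ∫⁻ y, η {x | (x ∈ U ∧ y ∈ U) ∧ dist y x < ε} ∂ν := by
    intro U hU ε
    have hA : MeasurableSet {p : X × X | (p.1 ∈ U ∧ p.2 ∈ U) ∧ dist p.2 p.1 < ε} := by
      apply IsOpen.measurableSet
      refine ((hU.preimage continuous_fst).inter (hU.preimage continuous_snd)).inter ?_
      exact isOpen_lt (f := fun p : X × X => dist p.2 p.1) (by fun_prop) continuous_const
    have h1 := Measure.prod_apply (μ := η) (ν := ν) hA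
    have h2 := Measure.prod_apply_symm (μ := η) (ν := ν) hA
    rw [h1] at h2
    exact h2
  have tot : ∀ ε : ℝ, ν (Metric.ball x₀ ε) * η Set.univ = η (Metric.ball x₀ ε) * ν Set.univ := by
    intro ε
    have h := key Set.univ isOpen_univ ε
    have e1 : ∀ x, ν {y | (x ∈ Set.univ ∧ y ∈ Set.univ) ∧ dist y x < ε} = ν (Metric.ball x₀ ε) := by
      intro x
      rw [hν ε x₀ x]; congr 1; ext y; simp [Metric.mem_ball]
    have e2 : ∀ y, η {x | (x ∈ Set.univ ∧ y ∈ Set.univ) ∧ dist y x < ε} = η (Metric.ball x₀ ε) := by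
      intro x
      rw [hη ε x₀ x]; congr 1; ext y; simp [Metric.mem_ball, dist_comm]
    simp only [e1, e2, lintegral_const] at h
    exact h
  have hopen : ∀ U : Set X, IsOpen U → η U ≤ (η Set.univ / ν Set.univ) * ν U := by
    intro U hU
    let V : ℕ → Set X := fun n => {x | Metric.ball x (1 / ((n : ℝ) + 1)) ⊆ U}
    have hV : ∀ n, η (V n) ≤ (η Set.univ / ν Set.univ) * ν U := by
      intro n
      set ε : ℝ := 1 / ((n : ℝ) + 1) with hε
      have hεp : 0 < ε := by positivity
      have ha : ν (Metric.ball x₀ ε) ≠ 0 :=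
        (Metric.isOpen_ball.measure_pos ν ⟨x₀, Metric.mem_ball_self hεp⟩).ne'
      have haT : ν (Metric.ball x₀ ε) ≠ ∞ := measure_ne_top _ _
      have h1 : ν (Metric.ball x₀ ε) * η (V n) ≤ η (Metric.ball x₀ ε) * ν U := by
        calc ν (Metric.ball x₀ ε) * η (V n) = ν (Metric.ball x₀ ε) * (η.restrict (V n)) Set.univ := by
              simp
          _ = ∫⁻ x in V n, ν (Metric.ball x₀ ε) ∂η := by simp
          _ ≤ ∫⁻ x in V n, ν {y | (x ∈ U ∧ y ∈ U) ∧ dist y x < ε} ∂η := by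
              apply setLIntegral_mono' 
              · have : V n = {x | Metric.ball x ε ⊆ U} := rfl
                have hc : IsClosed (V n) := by
                  have : V n = ⋂ y ∈ Uᶜ, {x | ε ≤ dist y x} := by
                    ext x
                    simp only [V, Set.mem_ofPred_eq, Set.mem_iInter, Set.subset_def, Metric.mem_ball, Set.mem_compl_iff]
                    constructor
                    · intro h y hy
                      by_contra hlt
                      exact hy (h y (not_le.mp hlt))
                    · intro h y hy
                      by_contra hyU
                      exact absurd (h y hyU) (not_le.mpr hy)
                  rw [this]
                  exact isClosed_biInter fun y _ => isClosed_le continuous_const (by fun_prop)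
                exact hc.measurableSet
              · intro x hx
                rw [hν ε x₀ x]
                apply measure_mono
                intro y hy
                exact ⟨⟨hx (Metric.mem_ball_self hεp), hx hy⟩, hy⟩
          _ ≤ ∫⁻ x, ν {y | (x ∈ U ∧ y ∈ U) ∧ dist y x < ε} ∂η := setLIntegral_le_lintegral _ _
          _ = ∫⁻ y, η {x | (x ∈ U ∧ y ∈ U) ∧ dist y x < ε} ∂ν := key U hU ε
          _ ≤ ∫⁻ y, U.indicator (fun _ => η (Metric.ball x₀ ε)) y ∂ν := by
              apply lintegral_mono
              intro y
              by_cases hy : y ∈ U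
              · simp only [Set.indicator_of_mem hy]
                rw [hη ε x₀ y]
                apply measure_mono
                intro x hx
                rw [Metric.mem_ball, dist_comm]; exact hx.2
              · simp [hy]
          _ = η (Metric.ball x₀ ε) * ν U := by
              rw [lintegral_indicator_const hU.measurableSet]
      have h2 := tot ε
      have h3 : η (Metric.ball x₀ ε) = ν (Metric.ball x₀ ε) * (η Set.univ / ν Set.univ) := by
        rw [← mul_div_assoc, h2, ENNReal.mul_div_cancel_right hS0 hST]
      rw [h3, mul_assoc] at h1
      exact (ENNReal.mul_le_mul_iff_right ha haT).mp h1
    have hUV : U = ⋃ n, V n := by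
      ext x
      simp only [Set.mem_iUnion, V, Set.mem_ofPred_eq]
      constructor
      · intro hx
        obtain ⟨ε, hε, hb⟩ := Metric.isOpen_iff.mp hU x hx
        obtain ⟨n, hn⟩ := exists_nat_one_div_lt hε
        exact ⟨n, (Metric.ball_subset_ball hn.le).trans hb⟩
      · rintro ⟨n, hn⟩
        exact hn (Metric.mem_ball_self (by positivity))
    have hmono : Monotone V := by
      intro n m hnm x hx
      refine (Metric.ball_subset_ball ?_).trans hx
      gcongr
    calc η U = η (⋃ n, V n) := by rw [← hUV]
      _ = ⨆ n, η (V n) := hmono.measure_iUnion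
      _ ≤ _ := iSup_le hV
  have hc : η Set.univ / ν Set.univ ≠ ∞ := ENNReal.div_ne_top (measure_ne_top _ _) hS0
  refine ⟨η Set.univ / ν Set.univ, hc, ?_⟩
  set c := η Set.univ / ν Set.univ with hcdef
  have : IsFiniteMeasure (c • ν) := ⟨by
    simpa using ENNReal.mul_lt_top hc.lt_top hST.lt_top⟩
  have hle : η ≤ c • ν := by
    intro s
    refine le_of_forall_gt fun r hr => ?_
    obtain ⟨U, hsU, hU, hUr⟩ := Set.exists_isOpen_lt_of_lt s r hr
    exact ((measure_mono hsU).trans (hopen U hU)).trans_lt hUr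
  refine Measure.eq_of_le_of_measure_univ_eq hle ?_
  simp [hcdef, ENNReal.div_mul_cancel hS0 hST]

theorem sphere_hausdorff_finite :
    (μH[2] : Measure (EuclideanSpace ℝ (Fin 3))) (Metric.sphere 0 1) < ∞ := by
  let g : (Fin 2 → ℝ) → EuclideanSpace ℝ (Fin 3) := fun p =>
    WithLp.toLp 2 ![Real.sin (p 0) * Real.cos (p 1), Real.sin (p 0) * Real.sin (p 1), Real.cos (p 0)]
  have hg : ContDiff ℝ 1 g := by
    rw [contDiff_euclidean]
    intro i
    fin_cases i <;> simp [g] <;> fun_prop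
  let K : Set (Fin 2 → ℝ) := Metric.closedBall 0 Real.pi
  have hK : IsCompact K := isCompact_closedBall _ _
  obtain ⟨C, hC⟩ := (hg.locallyLipschitz.locallyLipschitzOn (s := K)).exists_lipschitzOnWith_of_compact hK
  have hsub : Metric.sphere (0 : EuclideanSpace ℝ (Fin 3)) 1 ⊆ g '' K := by
    intro x hx
    have hn : x 0 ^ 2 + x 1 ^ 2 + x 2 ^ 2 = 1 := by
      have : ‖x‖ = 1 := by simpa using hx
      have h2 := EuclideanSpace.norm_sq_eq x
      rw [this] at h2
      simp [Fin.sum_univ_three] at h2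
      linarith
    let w : ℂ := ⟨x 0, x 1⟩
    have hw : ‖w‖ = Real.sqrt (1 - x 2 ^ 2) := by
      rw [Complex.norm_def, Complex.normSq_apply]
      congr 1
      simp only [w]; nlinarith
    have hz1 : -1 ≤ x 2 := by nlinarith [sq_nonneg (x 0), sq_nonneg (x 1)]
    have hz2 : x 2 ≤ 1 := by nlinarith [sq_nonneg (x 0), sq_nonneg (x 1)]
    refine ⟨![Real.arccos (x 2), Complex.arg w], ?_, ?_⟩
    · simp only [K, mem_closedBall_zero_iff]
      rw [pi_norm_le_iff_of_nonneg Real.pi_pos.le]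
      intro i
      fin_cases i
      · simp [abs_of_nonneg (Real.arccos_nonneg _), Real.arccos_le_pi]
      · simp [Complex.abs_arg_le_pi]
    · ext i
      fin_cases i
      · simp [g, Real.sin_arccos, ← hw, Complex.norm_mul_cos_arg, w]
      · simp [g, Real.sin_arccos, ← hw, Complex.norm_mul_sin_arg, w]
      · simp [g, Real.cos_arccos hz1 hz2]
  have h1 := hC.hausdorffMeasure_image_le (d := 2) (by norm_num)
  refine (measure_mono hsub).trans_lt (h1.trans_lt ?_)
  have h2 : (μH[2] : Measure (Fin 2 → ℝ)) = volume := by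
    have := hausdorffMeasure_pi_real (ι := Fin 2)
    simpa using this
  rw [h2]
  exact ENNReal.mul_lt_top (by simp) hK.measure_lt_top

theorem sphere_ball_move (x y : Metric.sphere (0 : EuclideanSpace ℝ (Fin 3)) 1) (ε : ℝ) :
    ∃ R : EuclideanSpace ℝ (Fin 3) ≃ₗᵢ[ℝ] EuclideanSpace ℝ (Fin 3),
      R '' (Subtype.val '' Metric.ball x ε) = Subtype.val '' Metric.ball y ε := by
  have hx : ‖(x : EuclideanSpace ℝ (Fin 3))‖ = 1 := by simp
  have hy : ‖(y : EuclideanSpace ℝ (Fin 3))‖ = 1 := by simp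
  refine ⟨(ℝ ∙ ((x : EuclideanSpace ℝ (Fin 3)) - y))ᗮ.reflection, ?_⟩
  have hR := Submodule.reflection_sub (hx.trans hy.symm)
  set R := (ℝ ∙ ((x : EuclideanSpace ℝ (Fin 3)) - y))ᗮ.reflection
  have char : ∀ z : Metric.sphere (0 : EuclideanSpace ℝ (Fin 3)) 1, ∀ u, 
      u ∈ Subtype.val '' Metric.ball z ε ↔ ‖u‖ = 1 ∧ dist u z < ε := by
    intro z u
    constructor
    · rintro ⟨u, hu, rfl⟩
      exact ⟨by simp, hu⟩
    · rintro ⟨h1, h2⟩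
      exact ⟨⟨u, by simpa using h1⟩, h2, rfl⟩
  ext u
  rw [char]
  constructor
  · rintro ⟨w, hw, rfl⟩
    rw [char] at hw
    refine ⟨by rw [R.norm_map]; exact hw.1, ?_⟩
    rw [← hR, R.dist_map]; exact hw.2
  · rintro ⟨h1, h2⟩
    refine ⟨R.symm u, (char _ _).mpr ⟨by rw [R.symm.norm_map]; exact h1, ?_⟩, by simp⟩
    rw [← R.dist_map, hR]; simpa using h2

/-- Hausdorff measure on the sphere, as a measure on the subtype. -/
noncomputable def etaS : Measure (Metric.sphere (0 : EuclideanSpace ℝ (Fin 3)) 1) :=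
  (μH[2] : Measure (EuclideanSpace ℝ (Fin 3))).comap Subtype.val

theorem etaS_apply (s : Set (Metric.sphere (0 : EuclideanSpace ℝ (Fin 3)) 1)) :
    etaS s = μH[2] ((Subtype.val '' s : Set (EuclideanSpace ℝ (Fin 3)))) :=
  (MeasurableEmbedding.subtype_coe Metric.isClosed_sphere.measurableSet).comap_apply _ _

instance : IsFiniteMeasure etaS := ⟨by
  rw [etaS_apply, Set.image_univ, Subtype.range_coe]; exact sphere_hausdorff_finite⟩

open scoped Pointwise in
theorem etaS_eq : ∃ c : ℝ≥0∞, c ≠ ∞ ∧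
    etaS = c • (volume : Measure (EuclideanSpace ℝ (Fin 3))).toSphere := by
  have hne : Nonempty (Metric.sphere (0 : EuclideanSpace ℝ (Fin 3)) 1) :=
    (NormedSpace.sphere_nonempty.mpr zero_le_one).to_subtype
  apply unif_distrib_aux
  · intro ε x y
    obtain ⟨R, hR⟩ := sphere_ball_move x y ε
    rw [Measure.toSphere_apply' _ Metric.isOpen_ball.measurableSet,
      Measure.toSphere_apply' _ Metric.isOpen_ball.measurableSet, ← hR]
    congr 1
    have : Set.Ioo (0:ℝ) 1 • (R '' (Subtype.val '' Metric.ball x ε)) =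
        R '' (Set.Ioo (0:ℝ) 1 • (Subtype.val '' Metric.ball x ε)) := by
      ext u
      simp only [Set.mem_smul, Set.mem_image]
      constructor
      · rintro ⟨r, hr, _, ⟨w, hw, rfl⟩, rfl⟩
        exact ⟨r • w, ⟨r, hr, w, hw, rfl⟩, by simp⟩
      · rintro ⟨_, ⟨r, hr, w, hw, rfl⟩, rfl⟩
        exact ⟨r, hr, R w, ⟨w, hw, rfl⟩, by simp⟩
    rw [this]
    have h2 := R.symm.measurePreserving.measure_preimage_emb R.symm.toHomeomorph.measurableEmbedding (Set.Ioo (0:ℝ) 1 • (Subtype.val '' Metric.ball x ε))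
    rw [← h2]
    congr 1
    exact (R.toEquiv.image_eq_preimage_symm _).symm
  · intro ε x y
    obtain ⟨R, hR⟩ := sphere_ball_move x y ε
    rw [etaS_apply, etaS_apply, ← hR]
    exact (R.isometry.hausdorffMeasure_image (Or.inl (by norm_num)) _).symm

theorem polar_lintegral (H : ℝ → EuclideanSpace ℝ (Fin 3) → ℝ≥0∞)
    (hH : Measurable fun p : ℝ × EuclideanSpace ℝ (Fin 3) => H p.1 p.2) :
    ∫⁻ u : EuclideanSpace ℝ (Fin 3), H ‖u‖ (‖u‖⁻¹ • u) =
      ∫⁻ r : Set.Ioi (0:ℝ), ∫⁻ ω, H r ω ∂(volume : Measure (EuclideanSpace ℝ (Fin 3))).toSphere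
        ∂(Measure.volumeIoiPow 2) := by
  have hmp := (volume : Measure (EuclideanSpace ℝ (Fin 3))).measurePreserving_homeomorphUnitSphereProd
  have hdim : Module.finrank ℝ (EuclideanSpace ℝ (Fin 3)) - 1 = 2 := by simp
  rw [hdim] at hmp
  have hm : Measurable fun p : Metric.sphere (0 : EuclideanSpace ℝ (Fin 3)) 1 × Set.Ioi (0:ℝ) =>
      H p.2 p.1 := hH.comp (f := fun p : Metric.sphere (0 : EuclideanSpace ℝ (Fin 3)) 1 × Set.Ioi (0:ℝ) =>
        ((p.2 : ℝ), (p.1 : EuclideanSpace ℝ (Fin 3)))) (by fun_prop)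
  have h1 := hmp.lintegral_comp hm
  rw [← lintegral_prod_symm' _ hm, ← h1]
  simp only [homeomorphUnitSphereProd_apply_snd_coe, homeomorphUnitSphereProd_apply_fst_coe]
  rw [lintegral_subtype_comap (measurableSet_singleton _).compl
    (fun u : EuclideanSpace ℝ (Fin 3) => H ‖u‖ (‖u‖⁻¹ • u))]
  rw [Measure.restrict_eq_self_of_ae_mem]
  exact compl_mem_ae_iff.mpr (measure_singleton _)

theorem polar_swap (G : ℝ → EuclideanSpace ℝ (Fin 3) → EuclideanSpace ℝ (Fin 3) → ℝ≥0∞)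
    (hG : Measurable fun p : ℝ × EuclideanSpace ℝ (Fin 3) × EuclideanSpace ℝ (Fin 3) =>
      G p.1 p.2.1 p.2.2) :
    ∫⁻ u : EuclideanSpace ℝ (Fin 3), ∫⁻ σ, G ‖u‖ (‖u‖⁻¹ • u) σ ∂etaS =
      ∫⁻ u : EuclideanSpace ℝ (Fin 3), ∫⁻ σ, G ‖u‖ σ (‖u‖⁻¹ • u) ∂etaS := by
  obtain ⟨c, hc, he⟩ := etaS_eq
  have m1 : Measurable fun q : (ℝ × EuclideanSpace ℝ (Fin 3)) ×
      Metric.sphere (0 : EuclideanSpace ℝ (Fin 3)) 1 => G q.1.1 q.1.2 q.2 :=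
    hG.comp (f := fun q : (ℝ × EuclideanSpace ℝ (Fin 3)) ×
      Metric.sphere (0 : EuclideanSpace ℝ (Fin 3)) 1 => (q.1.1, q.1.2, (q.2 : EuclideanSpace ℝ (Fin 3))))
      (by fun_prop)
  have m2 : Measurable fun q : (ℝ × EuclideanSpace ℝ (Fin 3)) ×
      Metric.sphere (0 : EuclideanSpace ℝ (Fin 3)) 1 => G q.1.1 q.2 q.1.2 :=
    hG.comp (f := fun q : (ℝ × EuclideanSpace ℝ (Fin 3)) ×
      Metric.sphere (0 : EuclideanSpace ℝ (Fin 3)) 1 => (q.1.1, (q.2 : EuclideanSpace ℝ (Fin 3)), q.1.2))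
      (by fun_prop)
  rw [polar_lintegral (fun r ω => ∫⁻ σ, G r ω σ ∂etaS) m1.lintegral_prod_right',
    polar_lintegral (fun r ω => ∫⁻ σ, G r σ ω ∂etaS) m2.lintegral_prod_right']
  refine lintegral_congr fun r => ?_
  have m3 : Measurable fun q : Metric.sphere (0 : EuclideanSpace ℝ (Fin 3)) 1 ×
      Metric.sphere (0 : EuclideanSpace ℝ (Fin 3)) 1 => G r q.1 q.2 :=
    hG.comp (f := fun q : Metric.sphere (0 : EuclideanSpace ℝ (Fin 3)) 1 ×
      Metric.sphere (0 : EuclideanSpace ℝ (Fin 3)) 1 =>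
        ((r : ℝ), (q.1 : EuclideanSpace ℝ (Fin 3)), (q.2 : EuclideanSpace ℝ (Fin 3))))
      (by fun_prop)
  have m4 : Measurable fun q : Metric.sphere (0 : EuclideanSpace ℝ (Fin 3)) 1 ×
      Metric.sphere (0 : EuclideanSpace ℝ (Fin 3)) 1 => G r q.2 q.1 := m3.comp measurable_swap
  simp only [he, lintegral_smul_measure, smul_eq_mul]
  rw [lintegral_const_mul _ m3.lintegral_prod_right', lintegral_const_mul _ m4.lintegral_prod_right',
    lintegral_lintegral_swap m3.aemeasurable]

theorem com_change (f : EuclideanSpace ℝ (Fin 3) → EuclideanSpace ℝ (Fin 3) → ℝ≥0∞)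
    (hf : Measurable fun p : EuclideanSpace ℝ (Fin 3) × EuclideanSpace ℝ (Fin 3) => f p.1 p.2) :
    ∫⁻ v, ∫⁻ vs, f v vs = ∫⁻ m, ∫⁻ u : EuclideanSpace ℝ (Fin 3),
      f (m + (1/2:ℝ) • u) (m - (1/2:ℝ) • u) := by
  have hv : ∀ v, ∫⁻ vs, f v vs = ∫⁻ u, f v (v - u) := fun v =>
    (lintegral_sub_left_eq_self (fun vs => f v vs) v).symm
  simp only [hv]
  have m1 : Measurable fun p : EuclideanSpace ℝ (Fin 3) × EuclideanSpace ℝ (Fin 3) =>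
      f p.1 (p.1 - p.2) :=
    hf.comp (f := fun p : EuclideanSpace ℝ (Fin 3) × EuclideanSpace ℝ (Fin 3) =>
      (p.1, p.1 - p.2)) (by fun_prop)
  have m2 : Measurable fun p : EuclideanSpace ℝ (Fin 3) × EuclideanSpace ℝ (Fin 3) =>
      f (p.1 + (1/2:ℝ) • p.2) (p.1 - (1/2:ℝ) • p.2) :=
    hf.comp (f := fun p : EuclideanSpace ℝ (Fin 3) × EuclideanSpace ℝ (Fin 3) =>
      (p.1 + (1/2:ℝ) • p.2, p.1 - (1/2:ℝ) • p.2)) (by fun_prop)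
  refine (lintegral_lintegral_swap m1.aemeasurable).trans (Eq.trans ?_ (lintegral_lintegral_swap m2.aemeasurable).symm)
  refine lintegral_congr fun u => ?_
  rw [← lintegral_add_right_eq_self (fun v => f v (v - u)) ((1/2:ℝ) • u)]
  refine lintegral_congr fun m => ?_
  congr 1
  module

/-- Pre/post-collisional change of variables. -/
theorem prepost (W : EuclideanSpace ℝ (Fin 3) → ℝ → ℝ → ℝ≥0∞)
    (hW : Measurable fun p : EuclideanSpace ℝ (Fin 3) × ℝ × ℝ => W p.1 p.2.1 p.2.2)
    (K : EuclideanSpace ℝ (Fin 3) → EuclideanSpace ℝ (Fin 3) → ℝ≥0∞)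
    (hK : Measurable fun p : EuclideanSpace ℝ (Fin 3) × EuclideanSpace ℝ (Fin 3) => K p.1 p.2) :
    ∫⁻ v : EuclideanSpace ℝ (Fin 3), ∫⁻ vs : EuclideanSpace ℝ (Fin 3),
      ∫⁻ σ : Metric.sphere (0 : EuclideanSpace ℝ (Fin 3)) 1,
        W (((1:ℝ)/2) • (v + vs)) ‖v - vs‖ ⟪‖v - vs‖⁻¹ • (v - vs), (σ : EuclideanSpace ℝ (Fin 3))⟫ *
        K (((1:ℝ)/2) • (v + vs) + (‖v - vs‖ / 2) • (σ : EuclideanSpace ℝ (Fin 3)))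
          (((1:ℝ)/2) • (v + vs) - (‖v - vs‖ / 2) • (σ : EuclideanSpace ℝ (Fin 3))) ∂etaS =
    ∫⁻ v : EuclideanSpace ℝ (Fin 3), ∫⁻ vs : EuclideanSpace ℝ (Fin 3),
      ∫⁻ σ : Metric.sphere (0 : EuclideanSpace ℝ (Fin 3)) 1,
        W (((1:ℝ)/2) • (v + vs)) ‖v - vs‖ ⟪‖v - vs‖⁻¹ • (v - vs), (σ : EuclideanSpace ℝ (Fin 3))⟫ *
        K v vs ∂etaS := by
  refine (com_change _ ?_).trans (Eq.trans ?_ (com_change _ ?_).symm)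
  · refine Measurable.lintegral_prod_right' (f := fun q : (EuclideanSpace ℝ (Fin 3) × EuclideanSpace ℝ (Fin 3)) × Metric.sphere (0 : EuclideanSpace ℝ (Fin 3)) 1 => W (((1:ℝ)/2) • (q.1.1 + q.1.2)) ‖q.1.1 - q.1.2‖ ⟪‖q.1.1 - q.1.2‖⁻¹ • (q.1.1 - q.1.2), (q.2 : EuclideanSpace ℝ (Fin 3))⟫ * K (((1:ℝ)/2) • (q.1.1 + q.1.2) + (‖q.1.1 - q.1.2‖ / 2) • (q.2 : EuclideanSpace ℝ (Fin 3)))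
          (((1:ℝ)/2) • (q.1.1 + q.1.2) - (‖q.1.1 - q.1.2‖ / 2) • (q.2 : EuclideanSpace ℝ (Fin 3)))) ?_
    apply Measurable.mul
    · exact hW.comp (f := fun q : (EuclideanSpace ℝ (Fin 3) × EuclideanSpace ℝ (Fin 3)) × Metric.sphere (0 : EuclideanSpace ℝ (Fin 3)) 1 =>
        (((1:ℝ)/2) • (q.1.1 + q.1.2), ‖q.1.1 - q.1.2‖, ⟪‖q.1.1 - q.1.2‖⁻¹ • (q.1.1 - q.1.2), (q.2 : EuclideanSpace ℝ (Fin 3))⟫)) (by fun_prop)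
    · exact hK.comp (f := fun q : (EuclideanSpace ℝ (Fin 3) × EuclideanSpace ℝ (Fin 3)) × Metric.sphere (0 : EuclideanSpace ℝ (Fin 3)) 1 => (((1:ℝ)/2) • (q.1.1 + q.1.2) + (‖q.1.1 - q.1.2‖ / 2) • (q.2 : EuclideanSpace ℝ (Fin 3)),
          ((1:ℝ)/2) • (q.1.1 + q.1.2) - (‖q.1.1 - q.1.2‖ / 2) • (q.2 : EuclideanSpace ℝ (Fin 3)))) (by fun_prop)
  · refine lintegral_congr fun m => ?_
    have e1 : ∀ u : EuclideanSpace ℝ (Fin 3),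
        ((1:ℝ)/2) • ((m + (1/2:ℝ) • u) + (m - (1/2:ℝ) • u)) = m := fun u => by module
    have e2 : ∀ u : EuclideanSpace ℝ (Fin 3),
        ((m + (1/2:ℝ) • u) - (m - (1/2:ℝ) • u)) = u := fun u => by module
    simp only [e1, e2]
    have := polar_swap (fun r ω σ => W m r ⟪ω, σ⟫ * K (m + (r / 2) • σ) (m - (r / 2) • σ)) (by
      apply Measurable.mul
      · exact hW.comp (f := fun p : ℝ × EuclideanSpace ℝ (Fin 3) × EuclideanSpace ℝ (Fin 3) =>
          (m, p.1, ⟪p.2.1, p.2.2⟫)) (by fun_prop)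
      · exact hK.comp (f := fun p : ℝ × EuclideanSpace ℝ (Fin 3) × EuclideanSpace ℝ (Fin 3) =>
          (m + (p.1 / 2) • p.2.2, m - (p.1 / 2) • p.2.2)) (by fun_prop))
    rw [this]
    refine lintegral_congr fun u => lintegral_congr fun σ => ?_
    have e3 : (‖u‖ / 2) • ‖u‖⁻¹ • u = (1/2:ℝ) • u := by
      by_cases hu : u = 0
      · simp [hu]
      · have : ‖u‖ ≠ 0 := norm_ne_zero_iff.mpr hu
        rw [smul_smul]; congr 1; field_simp
    rw [e3, real_inner_comm]
  · refine Measurable.lintegral_prod_right' (f := fun q : (EuclideanSpace ℝ (Fin 3) × EuclideanSpace ℝ (Fin 3)) × Metric.sphere (0 : EuclideanSpace ℝ (Fin 3)) 1 => W (((1:ℝ)/2) • (q.1.1 + q.1.2)) ‖q.1.1 - q.1.2‖ ⟪‖q.1.1 - q.1.2‖⁻¹ • (q.1.1 - q.1.2), (q.2 : EuclideanSpace ℝ (Fin 3))⟫ * K q.1.1 q.1.2) ?_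
    apply Measurable.mul
    · exact hW.comp (f := fun q : (EuclideanSpace ℝ (Fin 3) × EuclideanSpace ℝ (Fin 3)) × Metric.sphere (0 : EuclideanSpace ℝ (Fin 3)) 1 =>
        (((1:ℝ)/2) • (q.1.1 + q.1.2), ‖q.1.1 - q.1.2‖, ⟪‖q.1.1 - q.1.2‖⁻¹ • (q.1.1 - q.1.2), (q.2 : EuclideanSpace ℝ (Fin 3))⟫)) (by fun_prop)
    · exact hK.comp measurable_fst

theorem etaS_neg (f : EuclideanSpace ℝ (Fin 3) → ℝ≥0∞) :
    ∫⁻ σ : Metric.sphere (0 : EuclideanSpace ℝ (Fin 3)) 1, f (-σ) ∂etaS =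
      ∫⁻ σ : Metric.sphere (0 : EuclideanSpace ℝ (Fin 3)) 1, f σ ∂etaS := by
  unfold etaS
  rw [lintegral_subtype_comap Metric.isClosed_sphere.measurableSet (fun σ => f (-σ)),
    lintegral_subtype_comap Metric.isClosed_sphere.measurableSet f]
  have h1 := (IsometryEquiv.neg (EuclideanSpace ℝ (Fin 3))).measurePreserving_hausdorffMeasure 2
  have h2 := h1.setLIntegral_comp_preimage_emb
    (IsometryEquiv.neg (EuclideanSpace ℝ (Fin 3))).toHomeomorph.measurableEmbedding f
    (Metric.sphere 0 1)
  have h3 : (IsometryEquiv.neg (EuclideanSpace ℝ (Fin 3))) ⁻¹' (Metric.sphere 0 1) =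
      Metric.sphere 0 1 := by
    ext x; simp
  rw [h3] at h2
  exact h2

/-- The admissible triples `(m, r, c)` describing `Ξ̃_δ`. -/
def Pset (δ : ℝ) : Set (EuclideanSpace ℝ (Fin 3) × ℝ × ℝ) :=
  {p | Real.sqrt (2 * ‖p.1‖ ^ 2 + p.2.1 ^ 2 / 2) ≥ 1 / δ} ∪ ({p | p.2.1 ≤ 2 * δ} ∪
    ({p | p.2.1 ≥ 1 / δ} ∪ ({p | 1 - δ ≤ |p.2.2|} ∩ {p | |p.2.2| ≤ 1})))

theorem measurableSet_Pset (δ : ℝ) : MeasurableSet (Pset δ) := by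
  unfold Pset
  refine MeasurableSet.union ?_ (MeasurableSet.union ?_ (MeasurableSet.union ?_
    (MeasurableSet.inter ?_ ?_)))
  · exact measurableSet_le (by fun_prop) (by fun_prop)
  · exact measurableSet_le (by fun_prop) (by fun_prop)
  · exact measurableSet_le (by fun_prop) (by fun_prop)
  · exact measurableSet_le (by fun_prop) (by fun_prop)
  · exact measurableSet_le (by fun_prop) (by fun_prop)

theorem XiTilde_iff (δ : ℝ) (v vs σ : EuclideanSpace ℝ (Fin 3)) :
    XiTilde δ v vs σ ↔
      (((1:ℝ)/2) • (v + vs), ‖v - vs‖, ⟪‖v - vs‖⁻¹ • (v - vs), σ⟫) ∈ Pset δ := by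
  have h : 2 * ‖((1:ℝ)/2) • (v + vs)‖ ^ 2 + ‖v - vs‖ ^ 2 / 2 = ‖v‖ ^ 2 + ‖vs‖ ^ 2 := by
    have := parallelogram_law_with_norm ℝ v vs
    rw [norm_smul]
    norm_num
    nlinarith
  unfold XiTilde Pset
  simp only [Set.mem_union, Set.mem_inter_iff, Set.mem_ofPred_eq, h]

/-- The weight `1_{Ξ̃_δ} |v-v_*|^γ b(cos θ)` in the invariant variables. -/
noncomputable def Wf (γ : ℝ) (b : ℝ → ℝ) (δ : ℝ) (m : EuclideanSpace ℝ (Fin 3)) (r c : ℝ) : ℝ≥0∞ :=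
  (Pset δ).indicator (fun p => ENNReal.ofReal (p.2.1 ^ γ * b p.2.2)) (m, r, c)

theorem measurable_Wf (γ : ℝ) (b : ℝ → ℝ) (hb : Measurable b) (δ : ℝ) :
    Measurable fun p : EuclideanSpace ℝ (Fin 3) × ℝ × ℝ => Wf γ b δ p.1 p.2.1 p.2.2 := by
  have : Measurable ((Pset δ).indicator (fun p : EuclideanSpace ℝ (Fin 3) × ℝ × ℝ =>
      ENNReal.ofReal (p.2.1 ^ γ * b p.2.2))) := by
    refine Measurable.indicator ?_ (measurableSet_Pset δ)
    have h1 : Measurable fun p : EuclideanSpace ℝ (Fin 3) × ℝ × ℝ => p.2.1 ^ γ := by fun_prop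
    have h2 : Measurable fun p : EuclideanSpace ℝ (Fin 3) × ℝ × ℝ => b p.2.2 :=
      hb.comp (by fun_prop)
    exact (h1.mul h2).ennreal_ofReal
  exact this

/-- The weight on collision configurations. -/
noncomputable def Wt (γ : ℝ) (b : ℝ → ℝ) (δ : ℝ) (v vs σ : EuclideanSpace ℝ (Fin 3)) : ℝ≥0∞ :=
  Wf γ b δ (((1:ℝ)/2) • (v + vs)) ‖v - vs‖ ⟪‖v - vs‖⁻¹ • (v - vs), σ⟫

theorem measurable_Wt (γ : ℝ) (b : ℝ → ℝ) (hb : Measurable b) (δ : ℝ) :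
    Measurable fun p : EuclideanSpace ℝ (Fin 3) × EuclideanSpace ℝ (Fin 3) ×
      EuclideanSpace ℝ (Fin 3) => Wt γ b δ p.1 p.2.1 p.2.2 :=
  (measurable_Wf γ b hb δ).comp (f := fun p : EuclideanSpace ℝ (Fin 3) × EuclideanSpace ℝ (Fin 3) ×
      EuclideanSpace ℝ (Fin 3) => (((1:ℝ)/2) • (p.1 + p.2.1), ‖p.1 - p.2.1‖,
        ⟪‖p.1 - p.2.1‖⁻¹ • (p.1 - p.2.1), p.2.2⟫)) (by fun_prop)

theorem Wt_swap (γ : ℝ) (b : ℝ → ℝ) (δ : ℝ) (v vs σ : EuclideanSpace ℝ (Fin 3)) :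
    Wt γ b δ vs v (-σ) = Wt γ b δ v vs σ := by
  unfold Wt
  rw [add_comm vs v, norm_sub_rev vs v, inner_neg_right, ← inner_neg_left, ← smul_neg, neg_sub]

theorem Wt_of_mem (γ : ℝ) (b : ℝ → ℝ) (δ : ℝ) (v vs σ : EuclideanSpace ℝ (Fin 3))
    (h : XiTilde δ v vs σ) :
    Wt γ b δ v vs σ = ENNReal.ofReal (‖v - vs‖ ^ γ * b ⟪‖v - vs‖⁻¹ • (v - vs), σ⟫) := by
  unfold Wt Wf
  rw [Set.indicator_of_mem ((XiTilde_iff δ v vs σ).mp h)]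

theorem Wt_of_notMem (γ : ℝ) (b : ℝ → ℝ) (δ : ℝ) (v vs σ : EuclideanSpace ℝ (Fin 3))
    (h : ¬ XiTilde δ v vs σ) : Wt γ b δ v vs σ = 0 := by
  unfold Wt Wf
  rw [Set.indicator_of_notMem (fun h' => h ((XiTilde_iff δ v vs σ).mpr h'))]

theorem Wt_le (γ : ℝ) (b : ℝ → ℝ) (δ : ℝ) (v vs σ : EuclideanSpace ℝ (Fin 3)) :
    Wt γ b δ v vs σ ≤ ENNReal.ofReal (‖v - vs‖ ^ γ * b ⟪‖v - vs‖⁻¹ • (v - vs), σ⟫) := by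
  by_cases h : XiTilde δ v vs σ
  · rw [Wt_of_mem _ _ _ _ _ _ h]
  · rw [Wt_of_notMem _ _ _ _ _ _ h]; exact zero_le

theorem one_le_jap (v : EuclideanSpace ℝ (Fin 3)) : 1 ≤ jap v := by
  unfold jap
  rw [Real.one_le_sqrt]
  nlinarith [sq_nonneg ‖v‖]

theorem jap_pos (v : EuclideanSpace ℝ (Fin 3)) : 0 < jap v := zero_lt_one.trans_le (one_le_jap v)

theorem jap_sq (v : EuclideanSpace ℝ (Fin 3)) : jap v ^ 2 = 1 + ‖v‖ ^ 2 := by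
  unfold jap
  exact Real.sq_sqrt (by positivity)

theorem gauss_nonneg (v : EuclideanSpace ℝ (Fin 3)) : 0 ≤ gauss v := by
  unfold gauss; positivity

theorem measurable_jap : Measurable jap := by
  unfold jap; fun_prop

theorem measurable_gauss : Measurable gauss := by
  unfold gauss; fun_prop

/-- The kernel `μ(v_*)⟨v_*⟩²⟨v⟩^{2-k}`. -/
noncomputable def Kf (k : ℝ) (v vs : EuclideanSpace ℝ (Fin 3)) : ℝ≥0∞ :=
  ENNReal.ofReal (gauss vs * jap vs ^ 2 * jap v ^ (2 - k))

theorem measurable_Kf (k : ℝ) : Measurable fun p : EuclideanSpace ℝ (Fin 3) ×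
    EuclideanSpace ℝ (Fin 3) => Kf k p.1 p.2 := by
  unfold Kf
  have h1 := measurable_jap
  have h2 := measurable_gauss
  fun_prop

theorem Kf_lower (k : ℝ) (v a c : EuclideanSpace ℝ (Fin 3)) (h : jap v ^ 2 ≤ jap a ^ 2 * jap c ^ 2) :
    ENNReal.ofReal (gauss c * jap a ^ (-k) * jap v ^ 2) ≤ Kf k a c := by
  unfold Kf
  apply ENNReal.ofReal_le_ofReal
  have h1 : jap a ^ (2 - k) = jap a ^ 2 * jap a ^ (-k) := by
    rw [sub_eq_add_neg, Real.rpow_add (jap_pos a)]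
    norm_num
  rw [h1]
  calc gauss c * jap a ^ (-k) * jap v ^ 2 ≤ gauss c * jap a ^ (-k) * (jap a ^ 2 * jap c ^ 2) := by
        gcongr
        exact mul_nonneg (gauss_nonneg c) (Real.rpow_nonneg (jap_pos a).le _)
    _ = _ := by ring

/-- Triple integral over `ℝ³ × ℝ³ × S²`. -/
noncomputable def tri (f : EuclideanSpace ℝ (Fin 3) → EuclideanSpace ℝ (Fin 3) →
    EuclideanSpace ℝ (Fin 3) → ℝ≥0∞) : ℝ≥0∞ :=
  ∫⁻ v : EuclideanSpace ℝ (Fin 3), ∫⁻ vs : EuclideanSpace ℝ (Fin 3),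
      ∫⁻ σ : Metric.sphere (0 : EuclideanSpace ℝ (Fin 3)) 1, f v vs σ ∂etaS

theorem tri_meas1 (f : EuclideanSpace ℝ (Fin 3) → EuclideanSpace ℝ (Fin 3) →
    EuclideanSpace ℝ (Fin 3) → ℝ≥0∞)
    (hf : Measurable fun p : EuclideanSpace ℝ (Fin 3) × EuclideanSpace ℝ (Fin 3) ×
      EuclideanSpace ℝ (Fin 3) => f p.1 p.2.1 p.2.2) :
    Measurable fun p : EuclideanSpace ℝ (Fin 3) × EuclideanSpace ℝ (Fin 3) =>
      ∫⁻ σ : Metric.sphere (0 : EuclideanSpace ℝ (Fin 3)) 1, f p.1 p.2 σ ∂etaS :=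
  Measurable.lintegral_prod_right' (f := fun q : (EuclideanSpace ℝ (Fin 3) ×
    EuclideanSpace ℝ (Fin 3)) × Metric.sphere (0 : EuclideanSpace ℝ (Fin 3)) 1 =>
      f q.1.1 q.1.2 q.2) (hf.comp (f := fun q : (EuclideanSpace ℝ (Fin 3) ×
    EuclideanSpace ℝ (Fin 3)) × Metric.sphere (0 : EuclideanSpace ℝ (Fin 3)) 1 =>
      (q.1.1, q.1.2, (q.2 : EuclideanSpace ℝ (Fin 3)))) (by fun_prop))

theorem tri_add (f g : EuclideanSpace ℝ (Fin 3) → EuclideanSpace ℝ (Fin 3) →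
    EuclideanSpace ℝ (Fin 3) → ℝ≥0∞)
    (hf : Measurable fun p : EuclideanSpace ℝ (Fin 3) × EuclideanSpace ℝ (Fin 3) ×
      EuclideanSpace ℝ (Fin 3) => f p.1 p.2.1 p.2.2) :
    tri (fun v vs σ => f v vs σ + g v vs σ) = tri f + tri g := by
  unfold tri
  have m1 := tri_meas1 f hf
  rw [← lintegral_add_left m1.lintegral_prod_right']
  refine lintegral_congr fun v => ?_
  have m2 : Measurable fun vs => ∫⁻ σ : Metric.sphere (0 : EuclideanSpace ℝ (Fin 3)) 1,
      f v vs σ ∂etaS := m1.comp (f := fun vs => (v, vs)) measurable_prodMk_left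
  refine Eq.trans ?_ (lintegral_add_left m2 _)
  refine lintegral_congr fun vs => ?_
  rw [← lintegral_add_left]
  exact hf.comp (f := fun q : Metric.sphere (0 : EuclideanSpace ℝ (Fin 3)) 1 =>
    (v, vs, (q : EuclideanSpace ℝ (Fin 3)))) (by fun_prop)

theorem tri_swap (f : EuclideanSpace ℝ (Fin 3) → EuclideanSpace ℝ (Fin 3) →
    EuclideanSpace ℝ (Fin 3) → ℝ≥0∞)
    (hf : Measurable fun p : EuclideanSpace ℝ (Fin 3) × EuclideanSpace ℝ (Fin 3) ×
      EuclideanSpace ℝ (Fin 3) => f p.1 p.2.1 p.2.2) :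
    tri (fun v vs σ => f vs v (-σ)) = tri f := by
  unfold tri
  have h1 : ∀ v vs, ∫⁻ σ : Metric.sphere (0 : EuclideanSpace ℝ (Fin 3)) 1, f vs v (-σ) ∂etaS =
      ∫⁻ σ : Metric.sphere (0 : EuclideanSpace ℝ (Fin 3)) 1, f vs v σ ∂etaS :=
    fun v vs => etaS_neg (f vs v)
  simp only [h1]
  exact (lintegral_lintegral_swap (tri_meas1 f hf).aemeasurable).symm

theorem DeltaTilde_eq (γ k : ℝ) (b : ℝ → ℝ) (hb : Measurable b) (hb0 : ∀ x, 0 ≤ b x) (δ : ℝ) :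
    DeltaTilde γ k b δ = 3 * tri (fun v vs σ => Wt γ b δ v vs σ * Kf k v vs) := by
  unfold DeltaTilde tri
  have hm : Measurable fun p : EuclideanSpace ℝ (Fin 3) × EuclideanSpace ℝ (Fin 3) ×
      EuclideanSpace ℝ (Fin 3) => Wt γ b δ p.1 p.2.1 p.2.2 * Kf k p.1 p.2.1 :=
    (measurable_Wt γ b hb δ).mul ((measurable_Kf k).comp
      (f := fun p : EuclideanSpace ℝ (Fin 3) × EuclideanSpace ℝ (Fin 3) ×
      EuclideanSpace ℝ (Fin 3) => (p.1, p.2.1)) (by fun_prop))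
  congr 1
  refine Eq.trans ?_ (lintegral_lintegral_swap
    (tri_meas1 (fun v vs σ => Wt γ b δ v vs σ * Kf k v vs) hm).aemeasurable).symm
  refine lintegral_congr fun vs => lintegral_congr fun v => ?_
  unfold etaS
  rw [lintegral_subtype_comap Metric.isClosed_sphere.measurableSet
    (fun σ => Wt γ b δ v vs σ * Kf k v vs)]
  refine lintegral_congr fun σ => ?_
  by_cases h : XiTilde δ v vs σ
  · rw [Wt_of_mem _ _ _ _ _ _ h, Set.indicator_of_mem (by exact h), Kf, ← ENNReal.ofReal_mul]
    · congr 1; ring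
    · exact mul_nonneg (Real.rpow_nonneg (norm_nonneg _) _) (hb0 _)
  · rw [Wt_of_notMem _ _ _ _ _ _ h, Set.indicator_of_notMem (by exact h), zero_mul]

/-- The dominating integrand. -/
noncomputable def Tf (γ k : ℝ) (b : ℝ → ℝ) (δ : ℝ) (v vs σ : EuclideanSpace ℝ (Fin 3)) : ℝ≥0∞ :=
  Wt γ b δ v vs σ * Kf k (((1:ℝ)/2) • (v + vs) + (‖v - vs‖ / 2) • σ)
    (((1:ℝ)/2) • (v + vs) - (‖v - vs‖ / 2) • σ) +
  (Wt γ b δ v vs σ * Kf k (((1:ℝ)/2) • (v + vs) - (‖v - vs‖ / 2) • σ)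
    (((1:ℝ)/2) • (v + vs) + (‖v - vs‖ / 2) • σ) +
  Wt γ b δ v vs σ * Kf k vs v)

theorem tri_Tf (γ k : ℝ) (b : ℝ → ℝ) (hb : Measurable b) (hb0 : ∀ x, 0 ≤ b x) (δ : ℝ) :
    tri (Tf γ k b δ) = DeltaTilde γ k b δ := by
  have mW := measurable_Wt γ b hb δ
  have mK := measurable_Kf k
  have m0 : Measurable fun p : EuclideanSpace ℝ (Fin 3) × EuclideanSpace ℝ (Fin 3) ×
      EuclideanSpace ℝ (Fin 3) => Wt γ b δ p.1 p.2.1 p.2.2 * Kf k p.1 p.2.1 :=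
    mW.mul (mK.comp
      (f := fun p : EuclideanSpace ℝ (Fin 3) × EuclideanSpace ℝ (Fin 3) ×
      EuclideanSpace ℝ (Fin 3) => (p.1, p.2.1)) (by fun_prop))
  have m1 : Measurable fun p : EuclideanSpace ℝ (Fin 3) × EuclideanSpace ℝ (Fin 3) ×
      EuclideanSpace ℝ (Fin 3) => Wt γ b δ p.1 p.2.1 p.2.2 *
        Kf k (((1:ℝ)/2) • (p.1 + p.2.1) + (‖p.1 - p.2.1‖ / 2) • p.2.2)
          (((1:ℝ)/2) • (p.1 + p.2.1) - (‖p.1 - p.2.1‖ / 2) • p.2.2) :=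
    mW.mul (mK.comp
      (f := fun p : EuclideanSpace ℝ (Fin 3) × EuclideanSpace ℝ (Fin 3) ×
      EuclideanSpace ℝ (Fin 3) => (((1:ℝ)/2) • (p.1 + p.2.1) + (‖p.1 - p.2.1‖ / 2) • p.2.2,
          ((1:ℝ)/2) • (p.1 + p.2.1) - (‖p.1 - p.2.1‖ / 2) • p.2.2)) (by fun_prop))
  have m2 : Measurable fun p : EuclideanSpace ℝ (Fin 3) × EuclideanSpace ℝ (Fin 3) ×
      EuclideanSpace ℝ (Fin 3) => Wt γ b δ p.1 p.2.1 p.2.2 *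
        Kf k (((1:ℝ)/2) • (p.1 + p.2.1) - (‖p.1 - p.2.1‖ / 2) • p.2.2)
          (((1:ℝ)/2) • (p.1 + p.2.1) + (‖p.1 - p.2.1‖ / 2) • p.2.2) :=
    mW.mul (mK.comp
      (f := fun p : EuclideanSpace ℝ (Fin 3) × EuclideanSpace ℝ (Fin 3) ×
      EuclideanSpace ℝ (Fin 3) => (((1:ℝ)/2) • (p.1 + p.2.1) - (‖p.1 - p.2.1‖ / 2) • p.2.2,
          ((1:ℝ)/2) • (p.1 + p.2.1) + (‖p.1 - p.2.1‖ / 2) • p.2.2)) (by fun_prop))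
  unfold Tf
  rw [tri_add (fun v vs σ => Wt γ b δ v vs σ *
      Kf k (((1:ℝ)/2) • (v + vs) + (‖v - vs‖ / 2) • σ)
      (((1:ℝ)/2) • (v + vs) - (‖v - vs‖ / 2) • σ)) _ m1,
    tri_add (fun v vs σ => Wt γ b δ v vs σ *
      Kf k (((1:ℝ)/2) • (v + vs) - (‖v - vs‖ / 2) • σ)
      (((1:ℝ)/2) • (v + vs) + (‖v - vs‖ / 2) • σ)) _ m2]
  have e1 : tri (fun v vs σ => Wt γ b δ v vs σ *
      Kf k (((1:ℝ)/2) • (v + vs) + (‖v - vs‖ / 2) • σ)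
      (((1:ℝ)/2) • (v + vs) - (‖v - vs‖ / 2) • σ)) =
      tri (fun v vs σ => Wt γ b δ v vs σ * Kf k v vs) :=
    prepost (Wf γ b δ) (measurable_Wf γ b hb δ) (Kf k) mK
  have e2 : tri (fun v vs σ => Wt γ b δ v vs σ *
      Kf k (((1:ℝ)/2) • (v + vs) - (‖v - vs‖ / 2) • σ)
      (((1:ℝ)/2) • (v + vs) + (‖v - vs‖ / 2) • σ)) =
      tri (fun v vs σ => Wt γ b δ v vs σ * Kf k v vs) := by
    rw [← e1]
    rw [← tri_swap (fun v vs σ => Wt γ b δ v vs σ *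
      Kf k (((1:ℝ)/2) • (v + vs) + (‖v - vs‖ / 2) • σ)
      (((1:ℝ)/2) • (v + vs) - (‖v - vs‖ / 2) • σ)) m1]
    congr 1
    funext v vs σ
    rw [Wt_swap, add_comm vs v, norm_sub_rev vs v, smul_neg, sub_neg_eq_add, ← sub_eq_add_neg]
  have e3 : tri (fun v vs σ => Wt γ b δ v vs σ * Kf k vs v) =
      tri (fun v vs σ => Wt γ b δ v vs σ * Kf k v vs) := by
    rw [← tri_swap (fun v vs σ => Wt γ b δ v vs σ * Kf k v vs) m0]
    congr 1
    funext v vs σ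
    rw [Wt_swap]
  rw [e1, e2, e3, DeltaTilde_eq γ k b hb hb0]
  ring

theorem jap_prod_le (v a c : EuclideanSpace ℝ (Fin 3)) (h : ‖v‖ ^ 2 ≤ ‖a‖ ^ 2 + ‖c‖ ^ 2) :
    jap v ^ 2 ≤ jap a ^ 2 * jap c ^ 2 := by
  rw [jap_sq, jap_sq, jap_sq]
  nlinarith [mul_nonneg (sq_nonneg ‖a‖) (sq_nonneg ‖c‖)]

theorem energy (v vs σ : EuclideanSpace ℝ (Fin 3)) (hσ : ‖σ‖ = 1) :
    ‖((1:ℝ)/2) • (v + vs) + (‖v - vs‖ / 2) • σ‖ ^ 2 +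
      ‖((1:ℝ)/2) • (v + vs) - (‖v - vs‖ / 2) • σ‖ ^ 2 = ‖v‖ ^ 2 + ‖vs‖ ^ 2 := by
  have h1 := parallelogram_law_with_norm ℝ (((1:ℝ)/2) • (v + vs)) ((‖v - vs‖ / 2) • σ)
  have h2 := parallelogram_law_with_norm ℝ v vs
  have h3 : ‖((1:ℝ)/2) • (v + vs)‖ = 1 / 2 * ‖v + vs‖ := by rw [norm_smul]; norm_num
  have h4 : ‖(‖v - vs‖ / 2) • σ‖ = ‖v - vs‖ / 2 := by
    rw [norm_smul, hσ]; simp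
  rw [h3, h4] at h1
  nlinarith

theorem integrand_bound (γ k : ℝ) (b : ℝ → ℝ) (hb0 : ∀ x, 0 ≤ b x) (δ : ℝ)
    (Θ : EuclideanSpace ℝ (Fin 3) × EuclideanSpace ℝ (Fin 3) ×
      EuclideanSpace ℝ (Fin 3) → ℝ)
    (hΘ01 : ∀ p, 0 ≤ Θ p ∧ Θ p ≤ 1)
    (hΘsupp : ∀ v vs σ : EuclideanSpace ℝ (Fin 3),
      Θ (v, vs, σ) ≠ 1 → XiTilde δ v vs σ)
    (g : EuclideanSpace ℝ (Fin 3) → ℝ) (M : ℝ) (hM : 0 ≤ M)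
    (hg : ∀ v, |g v| ≤ M * jap v ^ (-k)) (v vs σ : EuclideanSpace ℝ (Fin 3)) (hσ : ‖σ‖ = 1) :
    ‖(1 - Θ (v, vs, σ)) *
        (gauss (((1:ℝ)/2) • (v + vs) - (‖v - vs‖ / 2) • σ) *
            g (((1:ℝ)/2) • (v + vs) + (‖v - vs‖ / 2) • σ) +
          gauss (((1:ℝ)/2) • (v + vs) + (‖v - vs‖ / 2) • σ) *
            g (((1:ℝ)/2) • (v + vs) - (‖v - vs‖ / 2) • σ) -
          gauss v * g vs) *
        b ⟪‖v - vs‖⁻¹ • (v - vs), σ⟫ * ‖v - vs‖ ^ γ‖ₑ * ENNReal.ofReal (jap v ^ 2) ≤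
      ENNReal.ofReal M * Tf γ k b δ v vs σ := by
  by_cases hX : XiTilde δ v vs σ
  swap
  · have : Θ (v, vs, σ) = 1 := by
      by_contra h; exact hX (hΘsupp v vs σ h)
    simp [this]
  have hen := energy v vs σ hσ
  unfold Tf
  rw [Wt_of_mem _ _ _ _ _ _ hX]
  set p := ((1:ℝ)/2) • (v + vs) + (‖v - vs‖ / 2) • σ
  set q := ((1:ℝ)/2) • (v + vs) - (‖v - vs‖ / 2) • σ
  set β := b ⟪‖v - vs‖⁻¹ • (v - vs), σ⟫
  have hβ : 0 ≤ β := hb0 _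
  set ρ := ‖v - vs‖ ^ γ
  have hρ : 0 ≤ ρ := Real.rpow_nonneg (norm_nonneg _) _
  have hv2 := sq_nonneg ‖vs‖
  have k1 := Kf_lower k v p q (jap_prod_le v p q (by linarith))
  have k2 := Kf_lower k v q p (jap_prod_le v q p (by linarith))
  have k3 := Kf_lower k v vs v (jap_prod_le v vs v (by linarith))
  have hT := hΘ01 (v, vs, σ)
  have gp := gauss_nonneg p
  have gq := gauss_nonneg q
  have gv := gauss_nonneg v
  have jr : ∀ w, 0 ≤ jap w ^ (-k) := fun w => Real.rpow_nonneg (jap_pos w).le _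
  have hreal : |(1 - Θ (v, vs, σ)) * (gauss q * g p + gauss p * g q - gauss v * g vs) * β * ρ| *
      jap v ^ 2 ≤ M * (ρ * β * (gauss q * jap p ^ (-k) * jap v ^ 2) +
        (ρ * β * (gauss p * jap q ^ (-k) * jap v ^ 2) + ρ * β * (gauss v * jap vs ^ (-k) * jap v ^ 2))) := by
    have a1 : |gauss q * g p + gauss p * g q - gauss v * g vs| ≤
        gauss q * (M * jap p ^ (-k)) + gauss p * (M * jap q ^ (-k)) + gauss v * (M * jap vs ^ (-k)) := by
      have b1 : |gauss q * g p| ≤ gauss q * (M * jap p ^ (-k)) := by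
        rw [abs_mul, abs_of_nonneg gq]; exact mul_le_mul_of_nonneg_left (hg p) gq
      have b2 : |gauss p * g q| ≤ gauss p * (M * jap q ^ (-k)) := by
        rw [abs_mul, abs_of_nonneg gp]; exact mul_le_mul_of_nonneg_left (hg q) gp
      have b3 : |gauss v * g vs| ≤ gauss v * (M * jap vs ^ (-k)) := by
        rw [abs_mul, abs_of_nonneg gv]; exact mul_le_mul_of_nonneg_left (hg vs) gv
      have c1 := abs_sub (gauss q * g p + gauss p * g q) (gauss v * g vs)
      have c2 := abs_add_le (gauss q * g p) (gauss p * g q)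
      linarith
    have a2 : |1 - Θ (v, vs, σ)| ≤ 1 := by rw [abs_le]; constructor <;> linarith
    rw [abs_mul, abs_mul, abs_mul, abs_of_nonneg hβ, abs_of_nonneg hρ]
    calc |1 - Θ (v, vs, σ)| * |gauss q * g p + gauss p * g q - gauss v * g vs| * β * ρ * jap v ^ 2
        ≤ 1 * (gauss q * (M * jap p ^ (-k)) + gauss p * (M * jap q ^ (-k)) +
          gauss v * (M * jap vs ^ (-k))) * β * ρ * jap v ^ 2 := by gcongr
      _ = _ := by ring
  have hβρ : 0 ≤ ρ * β := mul_nonneg hρ hβ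
  rw [← ofReal_norm_eq_enorm, Real.norm_eq_abs, ← ENNReal.ofReal_mul (abs_nonneg _)]
  refine (ENNReal.ofReal_le_ofReal hreal).trans ?_
  have j2 : 0 ≤ jap v ^ 2 := sq_nonneg _
  have n1 : 0 ≤ gauss q * jap p ^ (-k) * jap v ^ 2 := mul_nonneg (mul_nonneg gq (jr _)) j2
  have n2 : 0 ≤ gauss p * jap q ^ (-k) * jap v ^ 2 := mul_nonneg (mul_nonneg gp (jr _)) j2
  have n3 : 0 ≤ gauss v * jap vs ^ (-k) * jap v ^ 2 := mul_nonneg (mul_nonneg gv (jr _)) j2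
  rw [ENNReal.ofReal_mul hM, ENNReal.ofReal_add (mul_nonneg hβρ n1)
    (add_nonneg (mul_nonneg hβρ n2) (mul_nonneg hβρ n3)),
    ENNReal.ofReal_add (mul_nonneg hβρ n2) (mul_nonneg hβρ n3),
    ENNReal.ofReal_mul hβρ, ENNReal.ofReal_mul hβρ, ENNReal.ofReal_mul hβρ]
  gcongr

theorem B2_pointwise (γ k : ℝ) (b : ℝ → ℝ) (hb : Measurable b) (hb0 : ∀ x, 0 ≤ b x) (δ : ℝ)
    (Θ : EuclideanSpace ℝ (Fin 3) × EuclideanSpace ℝ (Fin 3) ×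
      EuclideanSpace ℝ (Fin 3) → ℝ)
    (hΘ01 : ∀ p, 0 ≤ Θ p ∧ Θ p ≤ 1)
    (hΘsupp : ∀ v vs σ : EuclideanSpace ℝ (Fin 3),
      Θ (v, vs, σ) ≠ 1 → XiTilde δ v vs σ)
    (h : EuclideanSpace ℝ (Fin 3) → EuclideanSpace ℝ (Fin 3) → ℝ) (M : ℝ) (hM : 0 ≤ M)
    (x : EuclideanSpace ℝ (Fin 3))
    (hg : ∀ v, |h x v| ≤ M * jap v ^ (-k)) (v : EuclideanSpace ℝ (Fin 3)) :
    ENNReal.ofReal (|B2 γ b Θ h x v| * jap v ^ 2) ≤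
      ENNReal.ofReal M * ∫⁻ vs : EuclideanSpace ℝ (Fin 3),
      ∫⁻ σ : Metric.sphere (0 : EuclideanSpace ℝ (Fin 3)) 1, Tf γ k b δ v vs σ ∂etaS := by
  rw [ENNReal.ofReal_mul (abs_nonneg _), ← Real.norm_eq_abs, ofReal_norm_eq_enorm]
  have hfin : ENNReal.ofReal (jap v ^ 2) ≠ ∞ := ENNReal.ofReal_ne_top
  unfold B2
  refine (mul_le_mul_left (enorm_integral_le_lintegral_enorm _) _).trans ?_
  rw [← lintegral_mul_const' _ _ hfin, ← lintegral_const_mul' _ _ ENNReal.ofReal_ne_top]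
  refine lintegral_mono fun vs => ?_
  refine (mul_le_mul_left (enorm_integral_le_lintegral_enorm _) _).trans ?_
  rw [← lintegral_mul_const' _ _ hfin, ← lintegral_const_mul' _ _ ENNReal.ofReal_ne_top]
  unfold etaS
  rw [lintegral_subtype_comap Metric.isClosed_sphere.measurableSet
    (fun σ => ENNReal.ofReal M * Tf γ k b δ v vs σ)]
  refine setLIntegral_mono' Metric.isClosed_sphere.measurableSet fun σ hσ => ?_
  exact integrand_bound γ k b hb0 δ Θ hΘ01 hΘsupp (h x) M hM hg v vs σ (by simpa using hσ)

theorem B2_first (γ k : ℝ) (b : ℝ → ℝ) (hb : Measurable b) (hb0 : ∀ x, 0 ≤ b x) (δ : ℝ)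
    (Θ : EuclideanSpace ℝ (Fin 3) × EuclideanSpace ℝ (Fin 3) ×
      EuclideanSpace ℝ (Fin 3) → ℝ)
    (hΘ01 : ∀ p, 0 ≤ Θ p ∧ Θ p ≤ 1)
    (hΘsupp : ∀ v vs σ : EuclideanSpace ℝ (Fin 3),
      Θ (v, vs, σ) ≠ 1 → XiTilde δ v vs σ)
    (Ω : Set (EuclideanSpace ℝ (Fin 3)))
    (h : EuclideanSpace ℝ (Fin 3) → EuclideanSpace ℝ (Fin 3) → ℝ)
    (M : ℝ) (hM : 0 ≤ M)
    (hbound : ∀ x ∈ Ω, ∀ v, |h x v| ≤ M * jap v ^ (-k)) :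
    (∫⁻ v : EuclideanSpace ℝ (Fin 3),
        ENNReal.ofReal ((⨆ x : Ω, |B2 γ b Θ h (x : EuclideanSpace ℝ (Fin 3)) v|) *
          jap v ^ 2)) ≤ DeltaTilde γ k b δ * ENNReal.ofReal M := by
  rw [← tri_Tf γ k b hb hb0, tri, mul_comm, ← lintegral_const_mul' _ _ ENNReal.ofReal_ne_top]
  refine lintegral_mono fun v => ?_
  have hx := fun x : Ω => B2_pointwise γ k b hb hb0 δ Θ hΘ01 hΘsupp h M hM x (hbound x x.2) v
  dsimp only
  set R := ENNReal.ofReal M * ∫⁻ vs : EuclideanSpace ℝ (Fin 3),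
      ∫⁻ σ : Metric.sphere (0 : EuclideanSpace ℝ (Fin 3)) 1, Tf γ k b δ v vs σ ∂etaS
  by_cases hR : R = ∞
  · rw [hR]; exact le_top
  have hj : 0 < jap v ^ 2 := pow_pos (jap_pos v) 2
  have hs : (⨆ x : Ω, |B2 γ b Θ h (x : EuclideanSpace ℝ (Fin 3)) v|) ≤ R.toReal / jap v ^ 2 := by
    refine Real.iSup_le (fun x => ?_) (by positivity)
    rw [le_div_iff₀ hj]
    exact (ENNReal.ofReal_le_iff_le_toReal hR).mp (hx x)
  rw [le_div_iff₀ hj] at hs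
  exact (ENNReal.ofReal_le_iff_le_toReal hR).mpr hs

theorem jap_integral_lt_top (r : ℝ) (hr : r < -3) :
    ∫⁻ v : EuclideanSpace ℝ (Fin 3), ENNReal.ofReal (jap v ^ r) < ∞ := by
  have h := integrable_rpow_neg_one_add_norm_sq (E := EuclideanSpace ℝ (Fin 3)) (μ := volume)
    (r := -r) (by simp; linarith)
  have h2 : ∀ v : EuclideanSpace ℝ (Fin 3), (1 + ‖v‖ ^ 2) ^ (-(-r) / 2) = jap v ^ r := by
    intro v
    unfold jap
    rw [Real.sqrt_eq_rpow, ← Real.rpow_mul (by positivity)]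
    congr 1; ring
  simp only [h2] at h
  exact h.lintegral_lt_top

theorem gauss_bound : ∃ C : ℝ, 0 ≤ C ∧ ∀ v : EuclideanSpace ℝ (Fin 3), ∀ γ : ℝ, γ ≤ 1 →
    gauss v * jap v ^ 2 * jap v ^ γ ≤ C * jap v ^ (-5 : ℝ) := by
  refine ⟨(2 * Real.pi) ^ (-(3:ℝ)/2) * (Real.exp (1/2) * 384), by positivity, fun v γ hγ => ?_⟩
  have hj := jap_pos v
  have h1 : jap v ^ γ ≤ jap v := by
    simpa using Real.rpow_le_rpow_of_exponent_le (one_le_jap v) hγ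
  have h2 : Real.exp (-‖v‖ ^ 2 / 2) ≤ Real.exp (1/2) * 384 * (jap v ^ 8)⁻¹ := by
    have e : -‖v‖ ^ 2 / 2 = 1/2 + -(jap v ^ 2 / 2) := by rw [jap_sq]; ring
    rw [e, Real.exp_add, mul_assoc]
    gcongr
    have h3 := Real.pow_div_factorial_le_exp (jap v ^ 2 / 2) (by positivity) 4
    rw [Real.exp_neg]
    have h4 : (384 * (jap v ^ 8)⁻¹ : ℝ) = ((jap v ^ 2 / 2) ^ 4 / (Nat.factorial 4 : ℕ))⁻¹ := by
      have : (Nat.factorial 4 : ℕ) = 24 := rfl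
      rw [this]; field_simp; norm_num
    rw [h4]
    exact inv_anti₀ (by positivity) h3
  have h5 : jap v ^ (-5 : ℝ) = (jap v ^ 8)⁻¹ * jap v ^ 2 * jap v := by
    rw [Real.rpow_neg hj.le]
    have : jap v ^ (5:ℝ) = jap v ^ 5 := by exact_mod_cast Real.rpow_natCast (jap v) 5
    rw [this]; field_simp
  rw [h5]
  unfold gauss
  calc (2 * Real.pi) ^ (-(3:ℝ)/2) * Real.exp (-‖v‖ ^ 2 / 2) * jap v ^ 2 * jap v ^ γ
      ≤ (2 * Real.pi) ^ (-(3:ℝ)/2) * (Real.exp (1/2) * 384 * (jap v ^ 8)⁻¹) * jap v ^ 2 * jap v := by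
        gcongr
    _ = _ := by ring

theorem norm_sub_rpow_le (γ : ℝ) (hγ0 : 0 ≤ γ) (v vs : EuclideanSpace ℝ (Fin 3)) :
    ‖v - vs‖ ^ γ ≤ 2 ^ γ * (jap v ^ γ * jap vs ^ γ) := by
  have hn : ∀ w : EuclideanSpace ℝ (Fin 3), ‖w‖ ≤ jap w := fun w =>
    Real.le_sqrt_of_sq_le (by linarith)
  have h1 := one_le_jap v
  have h2 := one_le_jap vs
  have h : ‖v - vs‖ ≤ 2 * (jap v * jap vs) := by
    have := norm_sub_le v vs
    nlinarith [hn v, hn vs]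
  rw [← Real.mul_rpow (by positivity) (by positivity), ← Real.mul_rpow (by norm_num) (by positivity)]
  exact Real.rpow_le_rpow (norm_nonneg _) h hγ0

theorem integrand_dom (γ k : ℝ) (hγ0 : 0 ≤ γ) (hγ1 : γ ≤ 1)
    (b : ℝ → ℝ) (bBdd : ℝ) (hb0 : ∀ x, 0 ≤ b x) (hb_bdd : ∀ x, b x ≤ bBdd) :
    ∃ C : ℝ≥0∞, C ≠ ∞ ∧ ∀ δ v vs σ, Wt γ b δ v vs σ * Kf k v vs ≤
      C * ENNReal.ofReal (jap v ^ (2 - k + γ)) * ENNReal.ofReal (jap vs ^ (-5 : ℝ)) := by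
  obtain ⟨C, hC0, hC⟩ := gauss_bound
  have hB : 0 ≤ bBdd := (hb0 0).trans (hb_bdd 0)
  refine ⟨ENNReal.ofReal (2 ^ γ * bBdd * C), ENNReal.ofReal_ne_top, fun δ v vs σ => ?_⟩
  refine (mul_le_mul_left (Wt_le γ b δ v vs σ) _).trans ?_
  have j1 := jap_pos v
  have j2 := jap_pos vs
  have g0 := gauss_nonneg vs
  unfold Kf
  rw [← ENNReal.ofReal_mul (mul_nonneg (by positivity) (hb0 _)),
    ← ENNReal.ofReal_mul (by positivity), ← ENNReal.ofReal_mul (by positivity)]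
  apply ENNReal.ofReal_le_ofReal
  calc ‖v - vs‖ ^ γ * b ⟪‖v - vs‖⁻¹ • (v - vs), σ⟫ * (gauss vs * jap vs ^ 2 * jap v ^ (2 - k))
      ≤ (2 ^ γ * (jap v ^ γ * jap vs ^ γ)) * bBdd * (gauss vs * jap vs ^ 2 * jap v ^ (2 - k)) := by
        have hn := norm_sub_rpow_le γ hγ0 v vs
        have hb' := hb_bdd ⟪‖v - vs‖⁻¹ • (v - vs), σ⟫
        have hb'' := hb0 ⟪‖v - vs‖⁻¹ • (v - vs), σ⟫
        gcongr
    _ = 2 ^ γ * bBdd * (gauss vs * jap vs ^ 2 * jap vs ^ γ) * (jap v ^ (2 - k) * jap v ^ γ) := by ring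
    _ ≤ 2 ^ γ * bBdd * (C * jap vs ^ (-5 : ℝ)) * (jap v ^ (2 - k) * jap v ^ γ) := by
        have := hC vs γ hγ1
        gcongr
    _ = _ := by rw [Real.rpow_add j1]; ring

theorem etaS_point (w : EuclideanSpace ℝ (Fin 3)) :
    ∀ᵐ σ : Metric.sphere (0 : EuclideanSpace ℝ (Fin 3)) 1 ∂etaS, (σ : EuclideanSpace ℝ (Fin 3)) ≠ w := by
  rw [ae_iff, etaS_apply]
  have := Measure.nullSingletonClass_hausdorff (EuclideanSpace ℝ (Fin 3)) (d := 2) (by norm_num)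
  refine measure_mono_null (t := {w}) ?_ (measure_singleton w)
  rintro _ ⟨σ, hσ, rfl⟩
  simpa using hσ

theorem eventually_notXi (v vs σ : EuclideanSpace ℝ (Fin 3)) (hne : v ≠ vs) (hσ : ‖σ‖ = 1)
    (h1 : σ ≠ ‖v - vs‖⁻¹ • (v - vs)) (h2 : σ ≠ -(‖v - vs‖⁻¹ • (v - vs))) :
    ∀ᶠ δ in nhdsWithin (0:ℝ) (Set.Ioi 0), ¬ XiTilde δ v vs σ := by
  have hr : 0 < ‖v - vs‖ := norm_pos_iff.mpr (sub_ne_zero.mpr hne)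
  have hu : ‖‖v - vs‖⁻¹ • (v - vs)‖ = 1 := by
    rw [norm_smul, norm_inv, norm_norm, inv_mul_cancel₀ hr.ne']
  unfold XiTilde
  set u := ‖v - vs‖⁻¹ • (v - vs)
  have hc : |⟪u, σ⟫| < 1 := by
    refine lt_of_le_of_ne (by simpa [hu, hσ] using abs_real_inner_le_norm u σ) fun h => ?_
    rcases eq_or_eq_neg_of_abs_eq h with h | h
    · exact h1 ((inner_eq_one_iff_of_norm_eq_one (𝕜 := ℝ) hu hσ).mp h).symm
    · have : ⟪-u, σ⟫ = 1 := by rw [inner_neg_left, h]; norm_num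
      exact h2 ((inner_eq_one_iff_of_norm_eq_one (𝕜 := ℝ) (by rw [norm_neg, hu]) hσ).mp this).symm
  have hinv : Filter.Tendsto (fun δ : ℝ => 1 / δ) (nhdsWithin (0:ℝ) (Set.Ioi 0)) Filter.atTop := by
    simpa using tendsto_inv_nhdsGT_zero (𝕜 := ℝ)
  have hid : Filter.Tendsto (fun δ : ℝ => δ) (nhdsWithin (0:ℝ) (Set.Ioi 0)) (nhds 0) :=
    tendsto_nhdsWithin_of_tendsto_nhds Filter.tendsto_id
  filter_upwards [hinv.eventually_gt_atTop (Real.sqrt (‖v‖ ^ 2 + ‖vs‖ ^ 2)),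
    hinv.eventually_gt_atTop ‖v - vs‖, hid.eventually_lt_const (half_pos hr),
    hid.eventually_lt_const (sub_pos.mpr hc)] with δ a1 a2 a3 a4
  rintro (h | h | h | h)
  · linarith
  · linarith
  · linarith
  · linarith [h.1]

theorem DeltaTilde_tendsto (γ k : ℝ) (hγ0 : 0 ≤ γ) (hγ1 : γ ≤ 1) (hk : 5 + γ < k)
    (b : ℝ → ℝ) (hb : Measurable b) (hb0 : ∀ x, 0 ≤ b x)
    (bBdd : ℝ) (hb_bdd : ∀ x, b x ≤ bBdd) :
    Filter.Tendsto (DeltaTilde γ k b) (nhdsWithin 0 (Set.Ioi 0)) (nhds 0) := by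
  obtain ⟨C, hC, hdom⟩ := integrand_dom γ k hγ0 hγ1 b bBdd hb0 hb_bdd
  have hA := jap_integral_lt_top (2 - k + γ) (by linarith)
  have hB := jap_integral_lt_top (-5) (by norm_num)
  have hE : etaS Set.univ ≠ ∞ := measure_ne_top _ _
  have hm : ∀ δ, Measurable fun p : EuclideanSpace ℝ (Fin 3) × EuclideanSpace ℝ (Fin 3) ×
      EuclideanSpace ℝ (Fin 3) => Wt γ b δ p.1 p.2.1 p.2.2 * Kf k p.1 p.2.1 := fun δ =>
    (measurable_Wt γ b hb δ).mul ((measurable_Kf k).comp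
      (f := fun p : EuclideanSpace ℝ (Fin 3) × EuclideanSpace ℝ (Fin 3) ×
      EuclideanSpace ℝ (Fin 3) => (p.1, p.2.1)) (by fun_prop))
  have hm1 := fun δ => tri_meas1 (fun v vs σ => Wt γ b δ v vs σ * Kf k v vs) (hm δ)
  -- bounds of the partial integrals
  have d1 : ∀ δ v vs, ∫⁻ σ : Metric.sphere (0 : EuclideanSpace ℝ (Fin 3)) 1,
      Wt γ b δ v vs σ * Kf k v vs ∂etaS ≤
      (C * ENNReal.ofReal (jap v ^ (2 - k + γ)) * etaS Set.univ) *
        ENNReal.ofReal (jap vs ^ (-5 : ℝ)) := by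
    intro δ v vs
    refine (lintegral_mono fun σ : Metric.sphere (0 : EuclideanSpace ℝ (Fin 3)) 1 => hdom δ v vs σ).trans ?_
    rw [lintegral_const]
    apply le_of_eq; ring
  have d2 : ∀ δ v, ∫⁻ vs : EuclideanSpace ℝ (Fin 3),
      ∫⁻ σ : Metric.sphere (0 : EuclideanSpace ℝ (Fin 3)) 1,
      Wt γ b δ v vs σ * Kf k v vs ∂etaS ≤
      (C * etaS Set.univ * ∫⁻ vs : EuclideanSpace ℝ (Fin 3), ENNReal.ofReal (jap vs ^ (-5 : ℝ))) *
        ENNReal.ofReal (jap v ^ (2 - k + γ)) := by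
    intro δ v
    refine (lintegral_mono fun vs => d1 δ v vs).trans ?_
    rw [lintegral_const_mul' _ _ (by finiteness)]
    apply le_of_eq; ring
  have main : Filter.Tendsto (fun δ => tri (fun v vs σ => Wt γ b δ v vs σ * Kf k v vs))
      (nhdsWithin 0 (Set.Ioi 0)) (nhds 0) := by
    unfold tri
    have z : (0 : ℝ≥0∞) = ∫⁻ _v : EuclideanSpace ℝ (Fin 3), 0 := by simp
    rw [z]
    refine tendsto_lintegral_filter_of_dominated_convergence _
      (Filter.Eventually.of_forall fun δ => (hm1 δ).lintegral_prod_right')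
      (Filter.Eventually.of_forall fun δ => Filter.Eventually.of_forall fun v => d2 δ v) ?_
      (Filter.Eventually.of_forall fun v => ?_)
    · rw [lintegral_const_mul' _ _ (by finiteness)]
      finiteness
    dsimp only
    rw [z]
    refine tendsto_lintegral_filter_of_dominated_convergence _
      (Filter.Eventually.of_forall fun δ => (hm1 δ).comp (f := fun vs => (v, vs)) measurable_prodMk_left)
      (Filter.Eventually.of_forall fun δ => Filter.Eventually.of_forall fun vs => d1 δ v vs) ?_ ?_
    · rw [lintegral_const_mul' _ _ (by finiteness)]
      finiteness
    have hne : ∀ᵐ vs : EuclideanSpace ℝ (Fin 3), vs ≠ v := by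
      rw [ae_iff]; simp
    filter_upwards [hne] with vs hvs
    have z' : (0 : ℝ≥0∞) = ∫⁻ _σ : Metric.sphere (0 : EuclideanSpace ℝ (Fin 3)) 1, 0 ∂etaS := by simp
    rw [z']
    refine tendsto_lintegral_filter_of_dominated_convergence
      (fun _ => C * ENNReal.ofReal (jap v ^ (2 - k + γ)) * ENNReal.ofReal (jap vs ^ (-5 : ℝ)))
      (Filter.Eventually.of_forall fun δ => (hm δ).comp
        (f := fun σ : Metric.sphere (0 : EuclideanSpace ℝ (Fin 3)) 1 =>
          (v, vs, (σ : EuclideanSpace ℝ (Fin 3)))) (by fun_prop))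
      (Filter.Eventually.of_forall fun δ => Filter.Eventually.of_forall fun σ => hdom δ v vs σ) ?_ ?_
    · rw [lintegral_const]; finiteness
    filter_upwards [etaS_point (‖v - vs‖⁻¹ • (v - vs)), etaS_point (-(‖v - vs‖⁻¹ • (v - vs)))]
      with σ s1 s2
    refine tendsto_const_nhds.congr' ?_
    filter_upwards [eventually_notXi v vs σ hvs.symm (by simp) s1 s2] with δ hδ
    rw [Wt_of_notMem _ _ _ _ _ _ hδ, zero_mul]
  have e : DeltaTilde γ k b = fun δ => 3 * tri (fun v vs σ => Wt γ b δ v vs σ * Kf k v vs) :=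
    funext fun δ => DeltaTilde_eq γ k b hb hb0 δ
  rw [e]
  have := ENNReal.Tendsto.const_mul (a := 3) main (Or.inr (by norm_num))
  simpa using this

/-- Mixed `L¹_v L^∞_x` estimate for `B₂^{(δ)}`: for `k > 5+γ` and `sup_x |h(x,v)| ≤ M⟨v⟩^{-k}`,
`∫ sup_x |B₂^{(δ)}h| ⟨v⟩² dv ≤ Δ̃_k(δ) M`, and `Δ̃_k(δ) → 0` as `δ → 0⁺`. -/
theorem B2_mixed_estimate
    (γ k : ℝ) (hγ0 : 0 ≤ γ) (hγ1 : γ ≤ 1) (hk : 5 + γ < k)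
    (b : ℝ → ℝ) (hb_meas : Measurable b) (hb_nonneg : ∀ x, 0 ≤ b x)
    (bBdd : ℝ) (hb_bdd : ∀ x, b x ≤ bBdd)
    (δ : ℝ) (hδ : 0 < δ)
    (Θ : EuclideanSpace ℝ (Fin 3) × EuclideanSpace ℝ (Fin 3) ×
      EuclideanSpace ℝ (Fin 3) → ℝ)
    (hΘ01 : ∀ p, 0 ≤ Θ p ∧ Θ p ≤ 1)
    (hΘsupp : ∀ v vs σ : EuclideanSpace ℝ (Fin 3),
      Θ (v, vs, σ) ≠ 1 → XiTilde δ v vs σ)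
    (Ω : Set (EuclideanSpace ℝ (Fin 3)))
    (h : EuclideanSpace ℝ (Fin 3) → EuclideanSpace ℝ (Fin 3) → ℝ)
    (M : ℝ) (hM : 0 ≤ M)
    (hbound : ∀ x ∈ Ω, ∀ v, |h x v| ≤ M * jap v ^ (-k)) :
    (∫⁻ v : EuclideanSpace ℝ (Fin 3),
        ENNReal.ofReal ((⨆ x : Ω, |B2 γ b Θ h (x : EuclideanSpace ℝ (Fin 3)) v|) *
          jap v ^ 2)) ≤ DeltaTilde γ k b δ * ENNReal.ofReal M ∧
    Filter.Tendsto (DeltaTilde γ k b) (nhdsWithin 0 (Set.Ioi 0)) (nhds 0) := by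
  exact ⟨B2_first γ k b hb_meas hb_nonneg δ Θ hΘ01 hΘsupp Ω h M hM hbound,
    DeltaTilde_tendsto γ k hγ0 hγ1 hk b hb_meas hb_nonneg bBdd hb_bdd⟩
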